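/- The SDE X_t = ∫_0^t μ(s, X_·) ds + B_t, t ∈ [0,T], driven by a one-dimensional Brownian motion B and with Tsirelson's drift μ, has no strong solution: there exists no process X, progressively measurable with respect to the (augmented) natural filtration of B, satisfying the equation almost surely. -/

import Mathlib

open MeasureTheory ProbabilityTheory Filter Set Matrix
open scoped Classical

noncomputable section

/-- The σ-algebra generated by the `P`-null sets. -/
def nullSets {Ω : Type*} [MeasurableSpace Ω] (P : Measure Ω) : MeasurableSpace Ω :=
  MeasurableSpace.generateFrom {s : Set Ω | P s = 0}

/-- The natural filtration of a process `u`. -/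
def natFilt {Ω E : Type*} [MeasurableSpace E] (u : ℝ → Ω → E) (s : ℝ) :
    MeasurableSpace Ω :=
  ⨆ r ∈ Set.Icc (0 : ℝ) s, MeasurableSpace.comap (u r) inferInstance

/-- The `P`-augmented natural filtration of a process `u`. -/
def augFilt {Ω E : Type*} [MeasurableSpace Ω] [MeasurableSpace E] (P : Measure Ω)
    (u : ℝ → Ω → E) (s : ℝ) : MeasurableSpace Ω :=
  natFilt u s ⊔ nullSets P

/-- Progressive measurability of a process `u` with respect to a family of σ-algebras `F`. -/
def ProgMeas {Ω E : Type*} [MeasurableSpace E] (F : ℝ → MeasurableSpace Ω)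
    (u : ℝ → Ω → E) : Prop :=
  ∀ s : ℝ, 0 ≤ s →
    @Measurable (Set.Icc (0 : ℝ) s × Ω) E
      (MeasurableSpace.prod inferInstance (F s)) _ (fun p => u p.1 p.2)

/-- Tsirelson's drift, relative to the time sequence `t : ℤ → ℝ`:
`μ(s, x) = fract ((x (t k) - x (t (k-1))) / (t k - t (k-1)))` for `s ∈ [t k, t (k+1))`,
`k ≤ -1`, and `0` otherwise. -/
def tsirelsonDrift (t : ℤ → ℝ) (s : ℝ) (x : ℝ → ℝ) : ℝ :=
  if h : ∃ k : ℤ, k ≤ -1 ∧ t k ≤ s ∧ s < t (k + 1) then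
    Int.fract ((x (t h.choose) - x (t (h.choose - 1))) / (t h.choose - t (h.choose - 1)))
  else 0

/-- The hypotheses on the time sequence: `t 0 = T`, strictly increasing, and
`t k ↓ 0` as `k → -∞`. -/
def TsirelsonTimes (T : ℝ) (t : ℤ → ℝ) : Prop :=
  t 0 = T ∧ (∀ k : ℤ, k ≤ 0 → t (k - 1) < t k) ∧
    Tendsto (fun n : ℕ => t (-(n : ℤ))) atTop (nhds 0)

/-- `B` is a one-dimensional `F`-Brownian motion under `P`: continuous paths started at `0`,
adapted, with increments that are centered Gaussian and independent of the past. -/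
def IsBM {Ω : Type*} [MeasurableSpace Ω] (P : Measure Ω) (F : ℝ → MeasurableSpace Ω)
    (B : ℝ → Ω → ℝ) : Prop :=
  (∀ ω, B 0 ω = 0) ∧ (∀ ω, Continuous fun s => B s ω) ∧
  (∀ s : ℝ, 0 ≤ s → Measurable[F s] (B s)) ∧
  (∀ s u : ℝ, 0 ≤ s → s < u →
    Measure.map (fun ω => B u ω - B s ω) P = gaussianReal 0 ((u - s).toNNReal) ∧
    Indep (MeasurableSpace.comap (fun ω => B u ω - B s ω) inferInstance) (F s) P)

section BrownianFiltration

variable {Ω : Type*} [MeasurableSpace Ω] {P : Measure Ω} {B : ℝ → Ω → ℝ}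

lemma augFilt_le_eventuallyMeasurableSpace (s : ℝ) :
    augFilt P B s ≤ eventuallyMeasurableSpace (natFilt B s) (ae P) := by
  refine sup_le le_eventuallyMeasurableSpace (MeasurableSpace.generateFrom_le fun A hA => ?_)
  exact ⟨∅, @MeasurableSet.empty _ (natFilt B s), ae_eq_empty.2 hA⟩

lemma measurable_augFilt {r s : ℝ} (hr : 0 ≤ r) (hrs : r ≤ s) :
    Measurable[augFilt P B s] (B r) := by
  refine Measurable.mono (comap_measurable (B r)) (le_trans ?_ le_sup_left) le_rfl
  exact le_iSup₂ (f := fun r (_ : r ∈ Set.Icc (0 : ℝ) s) =>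
    MeasurableSpace.comap (B r) inferInstance) r ⟨hr, hrs⟩

lemma augFilt_mono {s u : ℝ} (hsu : s ≤ u) : augFilt P B s ≤ augFilt P B u :=
  sup_le_sup_right (biSup_mono fun _ hr => ⟨hr.1, hr.2.trans hsu⟩) _

lemma ProgMeas.measurable_augFilt {X : ℝ → Ω → ℝ} (hX : ProgMeas (augFilt P B) X)
    {r s : ℝ} (hr : 0 ≤ r) (hrs : r ≤ s) : Measurable[augFilt P B s] (X r) := by
  have h : Measurable[augFilt P B r] (X r) := by
    let _ : MeasurableSpace Ω := augFilt P B r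
    exact (hX r hr).comp (measurable_prodMk_left (x := (⟨r, hr, le_rfl⟩ : Set.Icc (0 : ℝ) r)))
  exact h.mono (augFilt_mono hrs) le_rfl

lemma IsBM.aemeasurable (hB : IsBM P (natFilt B) B) {r : ℝ} (hr : 0 ≤ r) :
    AEMeasurable (B r) P := by
  rcases hr.eq_or_lt with rfl | hr
  · have : B 0 = fun _ => 0 := funext hB.1
    rw [this]
    exact aemeasurable_const
  · have h := (hB.2.2.2 0 r le_rfl hr).1
    simp only [hB.1, sub_zero] at h
    refine AEMeasurable.of_map_ne_zero ?_
    rw [h]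
    exact IsProbabilityMeasure.ne_zero _

lemma IsBM.natFilt_nullMeasurableSet (hB : IsBM P (natFilt B) B) {s : ℝ} {A : Set Ω}
    (hA : MeasurableSet[natFilt B s] A) : NullMeasurableSet A P := by
  have h : natFilt B s ≤ eventuallyMeasurableSpace inferInstance (ae P) := by
    refine iSup₂_le fun r hr => ?_
    rintro _ ⟨U, hU, rfl⟩
    exact (hB.aemeasurable hr.1).nullMeasurable hU
  exact h A hA

lemma IsBM.augFilt_nullMeasurableSet (hB : IsBM P (natFilt B) B) {s : ℝ} {A : Set Ω}
    (hA : MeasurableSet[augFilt P B s] A) : NullMeasurableSet A P := by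
  obtain ⟨A', hA', h⟩ := augFilt_le_eventuallyMeasurableSpace s A hA
  exact (hB.natFilt_nullMeasurableSet hA').congr h.symm

lemma IsBM.aemeasurable_of_augFilt (hB : IsBM P (natFilt B) B) {E : Type*} [MeasurableSpace E]
    [MeasurableSpace.CountablyGenerated E] {s : ℝ} {Y : Ω → E}
    (hY : Measurable[augFilt P B s] Y) : AEMeasurable Y P :=
  NullMeasurable.aemeasurable fun _ hU => hB.augFilt_nullMeasurableSet (hY hU)

/-- Increments of a Brownian motion are independent of the augmented past. -/
lemma IsBM.indepFun_increment (hB : IsBM P (natFilt B) B) {E : Type*} [MeasurableSpace E]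
    {s u : ℝ} (hs : 0 ≤ s) (hsu : s < u) {Y : Ω → E} (hY : Measurable[augFilt P B s] Y) :
    IndepFun Y (fun ω => B u ω - B s ω) P := by
  have h := (Indep_iff _ _ _).1 (hB.2.2.2 s u hs hsu).2
  refine (Indep_iff _ _ _).2 ?_
  rintro _ D ⟨U, hU, rfl⟩ hD
  obtain ⟨A, hA, hUA⟩ := augFilt_le_eventuallyMeasurableSpace s _ (hY hU)
  rw [measure_congr (hUA.inter (EventuallyEq.refl _ D)), measure_congr hUA, Set.inter_comm,
    h D A hD hA, mul_comm]

lemma IsBM.integral_mul_exp_increment [IsProbabilityMeasure P] (hB : IsBM P (natFilt B) B)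
    {s u : ℝ} (hs : 0 ≤ s) (hsu : s < u) {Y : Ω → ℂ} (hY : Measurable[augFilt P B s] Y) (c : ℝ) :
    ∫ ω, Y ω * Complex.exp ((c * (B u ω - B s ω) : ℝ) * Complex.I) ∂P
      = (∫ ω, Y ω ∂P) * (Real.exp (-((u - s) * c ^ 2 / 2)) : ℝ) := by
  have hD : AEMeasurable (fun ω => B u ω - B s ω) P :=
    (hB.aemeasurable (hs.trans hsu.le)).sub (hB.aemeasurable hs)
  have hg : Continuous fun x : ℝ => Complex.exp ((c * x : ℝ) * Complex.I) := by fun_prop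
  refine ((hB.indepFun_increment hs hsu hY).integral_fun_comp_mul_comp (f := id)
    (g := fun x : ℝ => Complex.exp ((c * x : ℝ) * Complex.I)) (hB.aemeasurable_of_augFilt hY) hD
    measurable_id.aestronglyMeasurable hg.aestronglyMeasurable).trans ?_
  congr 1
  rw [← integral_map (f := fun x : ℝ => Complex.exp ((c * x : ℝ) * Complex.I)) hD
    hg.aestronglyMeasurable, (hB.2.2.2 s u hs hsu).1]
  have h := charFun_gaussianReal (μ := 0) (v := (u - s).toNNReal) c
  rw [charFun_apply_real] at h
  push_cast
  rw [h]
  congr 1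
  have : ((u - s).toNNReal : ℝ) = u - s := Real.coe_toNNReal _ (sub_pos.2 hsu).le
  rw [← Complex.ofReal_inj] at this
  simp only [Complex.ofReal_zero, mul_zero, zero_mul, zero_sub]
  rw [this]
  push_cast
  ring

end BrownianFiltration

section Combination

variable {Ω : Type*} {B : ℝ → Ω → ℝ}

/-- The linear combination `∑ f r * B r` of the values of a process. -/
def processComb (B : ℝ → Ω → ℝ) (f : ℝ →₀ ℝ) (ω : Ω) : ℝ := f.sum fun r c => c * B r ω

lemma processComb_add (f g : ℝ →₀ ℝ) (ω : Ω) :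
    processComb B (f + g) ω = processComb B f ω + processComb B g ω :=
  Finsupp.sum_add_index' (by simp) (by intros; ring)

lemma processComb_single (r c : ℝ) (ω : Ω) :
    processComb B (Finsupp.single r c) ω = c * B r ω := by
  simp [processComb]

lemma processComb_neg (f : ℝ →₀ ℝ) (ω : Ω) :
    processComb B (-f) ω = -processComb B f ω := by
  have h := processComb_add (B := B) (-f) f ω
  rw [neg_add_cancel] at h
  simp only [processComb, Finsupp.sum_zero_index] at h ⊢
  linarith

lemma processComb_eq_erase_add (f : ℝ →₀ ℝ) (r : ℝ) (ω : Ω) :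
    processComb B f ω = processComb B (f.erase r) ω + f r * B r ω := by
  conv_lhs => rw [← Finsupp.erase_add_single r f]
  rw [processComb_add, processComb_single]

lemma measurable_processComb {m : MeasurableSpace Ω} {f : ℝ →₀ ℝ}
    (h : ∀ r ∈ f.support, Measurable (B r)) : Measurable (processComb B f) :=
  Finset.measurable_sum _ fun r hr => (h r hr).const_mul _

lemma measurable_mul_exp_ofReal {m : MeasurableSpace Ω} {Y : Ω → ℂ} {Z : Ω → ℝ}
    (hY : Measurable Y) (hZ : Measurable Z) :
    Measurable fun ω => Y ω * Complex.exp ((Z ω : ℝ) * Complex.I) := by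
  fun_prop

end Combination

section Orthogonality

variable {Ω : Type*} [MeasurableSpace Ω] {P : Measure Ω} {B : ℝ → Ω → ℝ}

/-- If `Y` is known at time `s` and orthogonal to all characters of `B s`, then it is orthogonal
to all characters of finitely many later values of `B`. -/
lemma IsBM.integral_mul_exp_eq_zero_of_present [IsProbabilityMeasure P]
    (hB : IsBM P (natFilt B) B) {s : ℝ} (hs : 0 ≤ s) {Y : Ω → ℂ}
    (hY : Measurable[augFilt P B s] Y)
    (h0 : ∀ c : ℝ, ∫ ω, Y ω * Complex.exp ((c * B s ω : ℝ) * Complex.I) ∂P = 0)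
    (f : ℝ →₀ ℝ) (hf : ∀ r ∈ f.support, s ≤ r) :
    ∫ ω, Y ω * Complex.exp ((processComb B f ω : ℝ) * Complex.I) ∂P = 0 := by
  suffices H : ∀ S : Finset ℝ, (∀ r ∈ S, s < r) → ∀ f : ℝ →₀ ℝ, f.support ⊆ insert s S →
      ∫ ω, Y ω * Complex.exp ((processComb B f ω : ℝ) * Complex.I) ∂P = 0 by
    refine H (f.support.erase s) (fun r hr => ?_) f (Finset.subset_insert_iff.2 subset_rfl)
    rw [Finset.mem_erase] at hr
    exact lt_of_le_of_ne (hf r hr.2) hr.1.symm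
  intro S
  induction S using Finset.induction_on_max with
  | empty =>
    intro _ f hf
    have hfs : f = Finsupp.single s (f s) := by
      rw [← Finsupp.support_subset_singleton]
      simpa using hf
    rw [hfs]
    simpa only [processComb_single] using h0 (f s)
  | insert m S hm ih =>
    intro hS f hf
    obtain ⟨p, hp, hmax⟩ := (insert s S).exists_max_image id ⟨s, by simp⟩
    have hsm : s < m := hS m (by simp)
    have hsp : s ≤ p := hmax s (by simp)
    have hpm : p < m := by
      rcases Finset.mem_insert.1 hp with rfl | hp
      · exact hsm
      · exact hm p hp
    let f' := f.erase m + Finsupp.single p (f m)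
    have hf' : f'.support ⊆ insert s S := by
      refine Finsupp.support_add.trans (Finset.union_subset ?_ ?_)
      · rw [Finsupp.support_erase]
        intro r hr
        rw [Finset.mem_erase] at hr
        have := hf hr.2
        simp only [Finset.mem_insert] at this ⊢
        tauto
      · refine Finsupp.support_single_subset.trans ?_
        simpa using hp
    have hdecomp : ∀ ω, Y ω * Complex.exp ((processComb B f ω : ℝ) * Complex.I)
        = (Y ω * Complex.exp ((processComb B f' ω : ℝ) * Complex.I))
          * Complex.exp ((f m * (B m ω - B p ω) : ℝ) * Complex.I) := by
      intro ω
      rw [mul_assoc, ← Complex.exp_add, ← add_mul, ← Complex.ofReal_add, processComb_add,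
        processComb_single, processComb_eq_erase_add f m]
      congr 4
      ring
    simp_rw [hdecomp]
    rw [hB.integral_mul_exp_increment (hs.trans hsp) hpm _ (f m),
      ih (fun r hr => hS r (Finset.mem_insert_of_mem hr)) f' hf', zero_mul]
    refine measurable_mul_exp_ofReal (hY.mono (augFilt_mono hsp) le_rfl)
      (measurable_processComb fun r hr => ?_)
    refine measurable_augFilt ?_ (hmax r (hf' hr))
    rcases Finset.mem_insert.1 (hf' hr) with rfl | hr
    · exact hs
    · exact hs.trans (hS r (Finset.mem_insert_of_mem hr)).le

end Orthogonality

section Determination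

variable {Ω : Type*} [MeasurableSpace Ω] {P : Measure Ω} {B : ℝ → Ω → ℝ}

/-- A finite measure absolutely continuous with respect to `P` under which `B` has the same
characters as under `P` agrees with `P` on the events generated by `B`. -/
lemma IsBM.measure_eq_of_integral_exp_eq [IsProbabilityMeasure P] (hB : IsBM P (natFilt B) B)
    {T : ℝ} {ν : Measure Ω} [IsFiniteMeasure ν] (hν : ν ≪ P)
    (h : ∀ f : ℝ →₀ ℝ, (∀ r ∈ f.support, r ∈ Set.Icc 0 T) →
      ∫ ω, Complex.exp ((processComb B f ω : ℝ) * Complex.I) ∂ν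
        = ∫ ω, Complex.exp ((processComb B f ω : ℝ) * Complex.I) ∂P)
    {A : Set Ω} (hA : MeasurableSet[augFilt P B T] A) : ν A = P A := by
  have hmap : ∀ F : Finset ℝ, (∀ r ∈ F, r ∈ Set.Icc 0 T) →
      ν.map (fun ω (r : F) => B r ω) = P.map (fun ω (r : F) => B r ω) := by
    intro F hF
    have hVP : AEMeasurable (fun ω (r : F) => B r ω) P :=
      aemeasurable_pi_lambda _ fun r => hB.aemeasurable (hF r r.2).1
    have hVν : AEMeasurable (fun ω (r : F) => B r ω) ν := hVP.mono_ac hν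
    refine Measure.ext_of_charFunDual ?_
    ext L
    have hL : Continuous fun x : F → ℝ => Complex.exp (L x * Complex.I) := by fun_prop
    rw [charFunDual_apply, charFunDual_apply,
      integral_map hVν hL.aestronglyMeasurable, integral_map hVP hL.aestronglyMeasurable]
    let f : ℝ →₀ ℝ := ∑ r : F, Finsupp.single (r : ℝ) (L (Pi.single r 1))
    have hf : ∀ r ∈ f.support, r ∈ Set.Icc 0 T := by
      intro r hr
      obtain ⟨q, -, hq⟩ := Finset.mem_biUnion.1 (Finsupp.support_finsetSum hr)
      have := Finset.mem_singleton.1 (Finsupp.support_single_subset hq)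
      exact this ▸ hF q q.2
    have hLf : ∀ ω, L (fun r : F => B r ω) = processComb B f ω := by
      intro ω
      have hsum : ∀ S : Finset F,
          processComb B (∑ r ∈ S, Finsupp.single (r : ℝ) (L (Pi.single r 1))) ω
            = ∑ r ∈ S, L (Pi.single r 1) * B r ω := by
        intro S
        induction S using Finset.induction_on with
        | empty => simp [processComb]
        | insert a S ha ih =>
          rw [Finset.sum_insert ha, Finset.sum_insert ha, processComb_add, ih,
            processComb_single]
      rw [hsum Finset.univ]
      conv_lhs => rw [pi_eq_sum_univ' (fun r : F => B r ω)]
      rw [map_sum]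
      refine Finset.sum_congr rfl fun r _ => ?_
      rw [map_smul, smul_eq_mul, mul_comm]
    simp_rw [hLf]
    exact h f hf
  have hnat : ∀ A, MeasurableSet[natFilt B T] A → ν A = P A := by
    have huniv : ν Set.univ = P Set.univ := by
      have := congrArg (fun μ => μ Set.univ) (hmap ∅ (by simp))
      have hV : ∀ μ : Measure Ω, AEMeasurable (fun ω (r : (∅ : Finset ℝ)) => B r ω) μ :=
        fun μ => aemeasurable_pi_lambda _ fun r => absurd r.2 (Finset.notMem_empty _)
      simpa [Measure.map_apply_of_aemeasurable (hV _)] using this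
    have hnull : ∀ A, MeasurableSet[natFilt B T] A →
        NullMeasurableSet A P ∧ NullMeasurableSet A ν := fun A hA =>
      ⟨hB.natFilt_nullMeasurableSet hA, (hB.natFilt_nullMeasurableSet hA).mono_ac hν⟩
    refine MeasurableSpace.induction_on_inter (m := natFilt B T)
      (generateFrom_piiUnionInter_measurableSet
        (fun r => MeasurableSpace.comap (B r) inferInstance) (Set.Icc 0 T)).symm
      (isPiSystem_piiUnionInter _ (fun r => @MeasurableSpace.isPiSystem_measurableSet _
        (MeasurableSpace.comap (B r) inferInstance)) _) (by simp) ?_ ?_ ?_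
    · rintro _ ⟨F, hF, S, hS, rfl⟩
      choose! U hU hUS using hS
      have hset : ⋂ r ∈ F, S r = (fun ω (r : F) => B r ω) ⁻¹' Set.univ.pi fun r => U r := by
        ext ω
        simp only [Set.mem_iInter, Set.mem_preimage, Set.mem_univ_pi, Subtype.forall]
        refine forall₂_congr fun r hr => ?_
        rw [← hUS r hr, Set.mem_preimage]
      have hVP : AEMeasurable (fun ω (r : F) => B r ω) P :=
        aemeasurable_pi_lambda _ fun r => hB.aemeasurable (hF r.2).1
      have hUm : MeasurableSet (Set.univ.pi fun r : F => U r) :=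
        MeasurableSet.univ_pi fun r => hU r r.2
      rw [hset, ← Measure.map_apply_of_aemeasurable (hVP.mono_ac hν) hUm,
        ← Measure.map_apply_of_aemeasurable hVP hUm, hmap F hF]
    · intro A hA ih
      rw [measure_compl₀ (hnull A hA).1 (measure_ne_top _ _),
        measure_compl₀ (hnull A hA).2 (measure_ne_top _ _), ih, huniv]
    · intro S hd hS ih
      have hd' : ∀ μ : Measure Ω, Pairwise (Function.onFun (AEDisjoint μ) S) := fun μ =>
        fun i j hij => (hd hij).aedisjoint
      rw [measure_iUnion₀ (hd' ν) fun i => (hnull _ (hS i)).2,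
        measure_iUnion₀ (hd' P) fun i => (hnull _ (hS i)).1]
      simp_rw [ih]
  obtain ⟨A', hA', hAA'⟩ := augFilt_le_eventuallyMeasurableSpace T A hA
  rw [measure_congr hAA', measure_congr (hν.ae_le hAA'), hnat A' hA']

lemma IsBM.ae_eq_zero_of_orthogonal [IsProbabilityMeasure P] (hB : IsBM P (natFilt B) B)
    {T : ℝ} {g : Ω → ℝ} (hg : Measurable[augFilt P B T] g) (hg1 : ∀ ω, |g ω| ≤ 1)
    (h : ∀ f : ℝ →₀ ℝ, (∀ r ∈ f.support, r ∈ Set.Icc 0 T) →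
      ∫ ω, (g ω : ℂ) * Complex.exp ((processComb B f ω : ℝ) * Complex.I) ∂P = 0) :
    g =ᵐ[P] 0 := by
  have hgm : AEMeasurable g P := hB.aemeasurable_of_augFilt hg
  have hgi : Integrable g P :=
    Integrable.of_bound hgm.aestronglyMeasurable 1 (ae_of_all _ hg1)
  have hpos : ∀ ω, 0 ≤ 1 + g ω := fun ω => by linarith [(abs_le.1 (hg1 ω)).1]
  have h1g : Integrable (fun ω => 1 + g ω) P := (integrable_const 1).add hgi
  let ν : Measure Ω := P.withDensity fun ω => ENNReal.ofReal (1 + g ω)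
  have hν : ν ≪ P := withDensity_absolutelyContinuous _ _
  have : IsFiniteMeasure ν := isFiniteMeasure_withDensity_ofReal h1g.2
  have hset : ∀ A, MeasurableSet[augFilt P B T] A → ∫ ω in A, g ω ∂P = 0 := by
    intro A hA
    have hνA : ν A = P A := by
      refine hB.measure_eq_of_integral_exp_eq hν (fun f hf => ?_) hA
      have hZ : AEStronglyMeasurable
          (fun ω => Complex.exp ((processComb B f ω : ℝ) * Complex.I)) P := by
        have hm := hB.aemeasurable_of_augFilt (s := T)
          (measurable_processComb fun r hr => measurable_augFilt (hf r hr).1 (hf r hr).2)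
        fun_prop
      have hZi : Integrable (fun ω => Complex.exp ((processComb B f ω : ℝ) * Complex.I)) P :=
        Integrable.of_bound hZ 1 (ae_of_all _ fun ω => (Complex.norm_exp_ofReal_mul_I _).le)
      have hgZi : Integrable
          (fun ω => (g ω : ℂ) * Complex.exp ((processComb B f ω : ℝ) * Complex.I)) P :=
        hgi.ofReal.mul_bdd (c := 1) hZ
          (ae_of_all _ fun ω => (Complex.norm_exp_ofReal_mul_I _).le)
      rw [integral_withDensity_eq_integral_toReal_smul₀
        (hgm.const_add 1).ennreal_ofReal (ae_of_all _ fun ω => ENNReal.ofReal_lt_top)]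
      have : ∀ ω, (ENNReal.ofReal (1 + g ω)).toReal
            • Complex.exp ((processComb B f ω : ℝ) * Complex.I)
          = Complex.exp ((processComb B f ω : ℝ) * Complex.I)
            + g ω * Complex.exp ((processComb B f ω : ℝ) * Complex.I) := by
        intro ω
        rw [ENNReal.toReal_ofReal (hpos ω), Complex.real_smul]
        push_cast
        ring
      simp_rw [this]
      rw [integral_add hZi hgZi, h f hf, add_zero]
    rw [withDensity_apply' _ A, ← ofReal_integral_eq_lintegral_ofReal h1g.integrableOn
      (ae_of_all _ hpos)] at hνA
    have hreal := congrArg ENNReal.toReal hνA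
    rw [ENNReal.toReal_ofReal (integral_nonneg hpos),
      integral_add (integrable_const 1) hgi.integrableOn] at hreal
    simpa [Measure.real] using hreal
  have hpos_part : P {ω | 0 < g ω} = 0 := by
    have hA : MeasurableSet[augFilt P B T] {ω | 0 < g ω} := hg measurableSet_Ioi
    have hA' := hB.augFilt_nullMeasurableSet hA
    have h0 := hset _ hA
    have hae : ∀ᵐ ω ∂P.restrict {ω | 0 < g ω}, 0 < g ω := ae_restrict_mem₀ hA'
    rw [setIntegral_eq_zero_iff_of_nonneg_ae (hae.mono fun _ => le_of_lt) hgi.integrableOn] at h0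
    have hF : ∀ᵐ ω ∂P.restrict {ω | 0 < g ω}, False := by
      filter_upwards [hae, h0] with ω h1 h2
      exact h1.ne' h2
    simpa [ae_iff] using hF
  have hneg_part : P {ω | g ω < 0} = 0 := by
    have hA : MeasurableSet[augFilt P B T] {ω | g ω < 0} := hg measurableSet_Iio
    have hA' := hB.augFilt_nullMeasurableSet hA
    have h0 : ∫ ω in {ω | g ω < 0}, -g ω ∂P = 0 := by rw [integral_neg, hset _ hA, neg_zero]
    have hae : ∀ᵐ ω ∂P.restrict {ω | g ω < 0}, g ω < 0 := ae_restrict_mem₀ hA'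
    rw [setIntegral_eq_zero_iff_of_nonneg_ae
      (hae.mono fun _ h => neg_nonneg.2 (le_of_lt h)) hgi.neg.integrableOn] at h0
    have hF : ∀ᵐ ω ∂P.restrict {ω | g ω < 0}, False := by
      filter_upwards [hae, h0] with ω h1 h2
      exact h1.ne (neg_eq_zero.1 h2)
    simpa [ae_iff] using hF
  have hp : ∀ᵐ ω ∂P, ¬ 0 < g ω := by simpa [ae_iff] using hpos_part
  have hn : ∀ᵐ ω ∂P, ¬ g ω < 0 := by simpa [ae_iff] using hneg_part
  filter_upwards [hp, hn] with ω h1 h2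
  exact le_antisymm (not_lt.1 h1) (not_lt.1 h2)

end Determination

section Drift

variable {T : ℝ} {t : ℤ → ℝ}

lemma TsirelsonTimes.strictAnti (ht : TsirelsonTimes T t) :
    StrictAnti fun n : ℕ => t (-(n : ℤ)) := by
  refine strictAnti_nat_of_succ_lt fun n => ?_
  have := ht.2.1 (-(n : ℤ)) (by lia)
  rwa [show -(n : ℤ) - 1 = -((n + 1 : ℕ) : ℤ) by push_cast; ring] at this

lemma TsirelsonTimes.pos (ht : TsirelsonTimes T t) (n : ℕ) : 0 < t (-(n : ℤ)) :=
  (ht.strictAnti.antitone.le_of_tendsto ht.2.2 (n + 1)).trans_lt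
    (ht.strictAnti (Nat.lt_succ_self n))

lemma TsirelsonTimes.le (ht : TsirelsonTimes T t) (n : ℕ) : t (-(n : ℤ)) ≤ T := by
  have := ht.strictAnti.antitone (Nat.zero_le n)
  simpa [ht.1] using this

lemma TsirelsonTimes.interval_unique (ht : TsirelsonTimes T t) {j k : ℤ} (hj : j ≤ -1)
    (hk : k ≤ -1) {s : ℝ} (hjs : t j ≤ s ∧ s < t (j + 1)) (hks : t k ≤ s ∧ s < t (k + 1)) :
    j = k := by
  have mono : ∀ a b : ℤ, a ≤ b → b ≤ 0 → t a ≤ t b := by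
    intro a b hab hb
    have := ht.strictAnti.antitone (Int.toNat_le_toNat (neg_le_neg hab))
    simpa [Int.toNat_of_nonneg (neg_nonneg.2 hb),
      Int.toNat_of_nonneg (neg_nonneg.2 (hab.trans hb))] using this
  rcases lt_trichotomy j k with h | h | h
  · linarith [mono (j + 1) k (by lia) (by lia), hjs.2, hks.1]
  · exact h
  · linarith [mono (k + 1) j (by lia) (by lia), hjs.1, hks.2]

/-- The normalised increment of a path over the interval indexed by `k`. -/
def pathSlope (t : ℤ → ℝ) (k : ℤ) (x : ℝ → ℝ) : ℝ :=
  (x (t k) - x (t (k - 1))) / (t k - t (k - 1))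

lemma TsirelsonTimes.drift_eq (ht : TsirelsonTimes T t) {k : ℤ} (hk : k ≤ -1) {s : ℝ}
    (hs : t k ≤ s ∧ s < t (k + 1)) (x : ℝ → ℝ) :
    tsirelsonDrift t s x = Int.fract (pathSlope t k x) := by
  have h : ∃ k : ℤ, k ≤ -1 ∧ t k ≤ s ∧ s < t (k + 1) := ⟨k, hk, hs⟩
  have hc : h.choose = k := ht.interval_unique h.choose_spec.1 hk h.choose_spec.2 hs
  rw [tsirelsonDrift, dif_pos h, hc, pathSlope]

lemma TsirelsonTimes.measurable_drift (ht : TsirelsonTimes T t) (x : ℝ → ℝ) :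
    Measurable fun s => tsirelsonDrift t s x := by
  have hI : ∀ k : ℤ, MeasurableSet {s : ℝ | k ≤ -1 ∧ t k ≤ s ∧ s < t (k + 1)} := fun k =>
    (MeasurableSet.const _).inter measurableSet_Ico
  intro A hA
  have hset : (fun s => tsirelsonDrift t s x) ⁻¹' A =
      (⋃ k : ℤ, {s : ℝ | k ≤ -1 ∧ t k ≤ s ∧ s < t (k + 1)} ∩
        {_s : ℝ | Int.fract (pathSlope t k x) ∈ A}) ∪
      ((⋃ k : ℤ, {s : ℝ | k ≤ -1 ∧ t k ≤ s ∧ s < t (k + 1)})ᶜ ∩ {_s : ℝ | (0 : ℝ) ∈ A}) := by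
    ext s
    by_cases h : ∃ k : ℤ, k ≤ -1 ∧ t k ≤ s ∧ s < t (k + 1)
    · obtain ⟨k, hk, hs⟩ := h
      simp only [Set.mem_preimage, ht.drift_eq hk hs, Set.mem_union, Set.mem_iUnion,
        Set.mem_inter_iff, Set.mem_ofPred_eq, Set.mem_compl_iff]
      constructor
      · exact fun hA => Or.inl ⟨k, ⟨hk, hs⟩, hA⟩
      · rintro (⟨j, ⟨hj, hjs⟩, hA⟩ | ⟨hn, -⟩)
        · rwa [← ht.interval_unique hj hk hjs hs]
        · exact absurd ⟨k, hk, hs⟩ hn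
    · have h0 : tsirelsonDrift t s x = 0 := dif_neg h
      simp only [Set.mem_preimage, h0, Set.mem_union, Set.mem_iUnion, Set.mem_inter_iff,
        Set.mem_ofPred_eq, Set.mem_compl_iff]
      constructor
      · exact fun hA => Or.inr ⟨h, hA⟩
      · rintro (⟨j, hj, -⟩ | ⟨-, hA⟩)
        · exact absurd ⟨j, hj⟩ h
        · exact hA
  rw [hset]
  exact (MeasurableSet.iUnion fun k => (hI k).inter (MeasurableSet.const _)).union
    ((MeasurableSet.iUnion hI).compl.inter (MeasurableSet.const _))

lemma abs_tsirelsonDrift_le_one (s : ℝ) (x : ℝ → ℝ) : |tsirelsonDrift t s x| ≤ 1 := by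
  rw [tsirelsonDrift]
  split_ifs
  · rw [Int.abs_fract]
    exact (Int.fract_lt_one _).le
  · simp

lemma TsirelsonTimes.setIntegral_drift (ht : TsirelsonTimes T t) (n : ℕ) (x : ℝ → ℝ) :
    ∫ r in Set.Icc 0 (t (-(n : ℤ))), tsirelsonDrift t r x
      = (∫ r in Set.Icc 0 (t (-((n + 1 : ℕ) : ℤ))), tsirelsonDrift t r x)
        + (t (-(n : ℤ)) - t (-((n + 1 : ℕ) : ℤ)))
          * Int.fract (pathSlope t (-((n + 1 : ℕ) : ℤ)) x) := by
  have hlt : t (-((n + 1 : ℕ) : ℤ)) < t (-(n : ℤ)) := ht.strictAnti (Nat.lt_succ_self n)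
  have hpos := ht.pos (n + 1)
  have hint : ∀ a b : ℝ, IntegrableOn (fun r => tsirelsonDrift t r x) (Set.Icc a b) := fun a b =>
    Measure.integrableOn_of_bounded (M := 1) (by simp)
      (ht.measurable_drift x).aestronglyMeasurable
      (ae_of_all _ fun r => abs_tsirelsonDrift_le_one r x)
  rw [← Set.Icc_union_Ioc_eq_Icc hpos.le hlt.le, setIntegral_union
    (Set.disjoint_left.2 fun r h1 h2 => h2.1.not_ge h1.2) measurableSet_Ioc (hint _ _)
    ((hint _ _).mono_set Set.Ioc_subset_Icc_self), ← integral_Icc_eq_integral_Ioc]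
  congr 1
  rw [integral_Icc_eq_integral_Ico]
  rw [setIntegral_congr_fun (g := fun _ => Int.fract (pathSlope t (-((n + 1 : ℕ) : ℤ)) x))
    measurableSet_Ico fun r hr => ?_]
  · rw [setIntegral_const, Real.volume_real_Ico_of_le hlt.le, smul_eq_mul]
  · refine ht.drift_eq (by push_cast; lia) ⟨hr.1, ?_⟩ x
    rw [show -((n + 1 : ℕ) : ℤ) + 1 = -(n : ℤ) by push_cast; ring]
    exact hr.2

end Drift

section Solution

variable {T : ℝ} {t : ℤ → ℝ}

/-- The fractional parts of the slopes of a solution are advanced by the driving increments. -/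
lemma TsirelsonTimes.exp_pathSlope (ht : TsirelsonTimes T t) {x b : ℝ → ℝ}
    (hx : ∀ s ∈ Set.Icc (0 : ℝ) T,
      x s = (∫ r in Set.Icc (0 : ℝ) s, tsirelsonDrift t r x) + b s) (n : ℕ) :
    Complex.exp ((2 * Real.pi * pathSlope t (-(n : ℤ)) x : ℝ) * Complex.I)
      = Complex.exp ((2 * Real.pi * pathSlope t (-((n + 1 : ℕ) : ℤ)) x : ℝ) * Complex.I)
        * Complex.exp ((2 * Real.pi / (t (-(n : ℤ)) - t (-((n + 1 : ℕ) : ℤ)))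
          * (b (t (-(n : ℤ))) - b (t (-((n + 1 : ℕ) : ℤ)))) : ℝ) * Complex.I) := by
  have hΔ : 0 < t (-(n : ℤ)) - t (-((n + 1 : ℕ) : ℤ)) :=
    sub_pos.2 (ht.strictAnti (Nat.lt_succ_self n))
  have hslope : pathSlope t (-(n : ℤ)) x = Int.fract (pathSlope t (-((n + 1 : ℕ) : ℤ)) x)
      + (b (t (-(n : ℤ))) - b (t (-((n + 1 : ℕ) : ℤ))))
        / (t (-(n : ℤ)) - t (-((n + 1 : ℕ) : ℤ))) := by
    have h1 := hx _ ⟨(ht.pos n).le, ht.le n⟩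
    have h2 := hx _ ⟨(ht.pos (n + 1)).le, ht.le (n + 1)⟩
    rw [ht.setIntegral_drift n x] at h1
    conv_lhs => rw [pathSlope, show -(n : ℤ) - 1 = -((n + 1 : ℕ) : ℤ) by push_cast; ring]
    rw [h1, h2]
    field_simp
    ring
  rw [← Complex.exp_add, Complex.exp_eq_exp_iff_exists_int]
  refine ⟨-⌊pathSlope t (-((n + 1 : ℕ) : ℤ)) x⌋, ?_⟩
  rw [hslope, Int.fract]
  generalize pathSlope t (-((n + 1 : ℕ) : ℤ)) x = p
  push_cast
  ring

variable {Ω : Type*} {X : ℝ → Ω → ℝ}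

/-- The phase `exp (2πi a)` of the slope `a` of `X` over the interval ending at `t (-n)`. -/
def slopePhase (t : ℤ → ℝ) (X : ℝ → Ω → ℝ) (n : ℕ) (ω : Ω) : ℂ :=
  Complex.exp ((2 * Real.pi * pathSlope t (-(n : ℤ)) (fun u => X u ω) : ℝ) * Complex.I)

lemma norm_slopePhase (n : ℕ) (ω : Ω) : ‖slopePhase t X n ω‖ = 1 :=
  Complex.norm_exp_ofReal_mul_I _

variable [MeasurableSpace Ω] {P : Measure Ω} {B : ℝ → Ω → ℝ}

lemma TsirelsonTimes.measurable_slopePhase (ht : TsirelsonTimes T t)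
    (hX : ProgMeas (augFilt P B) X) (n : ℕ) :
    Measurable[augFilt P B (t (-(n : ℤ)))] (slopePhase t X n) := by
  have h1 := hX.measurable_augFilt (ht.pos n).le le_rfl
  have h2 := hX.measurable_augFilt (ht.pos (n + 1)).le (ht.strictAnti (Nat.lt_succ_self n)).le
  rw [show -((n + 1 : ℕ) : ℤ) = -(n : ℤ) - 1 by push_cast; ring] at h2
  let _ : MeasurableSpace Ω := augFilt P B (t (-(n : ℤ)))
  unfold slopePhase pathSlope
  fun_prop

/-- The phase of the slope is orthogonal to all characters of the present value of `B`. -/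
lemma IsBM.integral_slopePhase_mul_exp_present [IsProbabilityMeasure P]
    (hB : IsBM P (natFilt B) B) (ht : TsirelsonTimes T t) (hX : ProgMeas (augFilt P B) X)
    (hsol : ∀ᵐ ω ∂P, ∀ s ∈ Set.Icc (0 : ℝ) T,
      X s ω = (∫ r in Set.Icc (0 : ℝ) s, tsirelsonDrift t r (fun u => X u ω)) + B s ω)
    (c : ℝ) (n : ℕ) :
    ∫ ω, slopePhase t X n ω * Complex.exp ((c * B (t (-(n : ℤ))) ω : ℝ) * Complex.I) ∂P = 0 := by
  let Δ : ℕ → ℝ := fun n => t (-(n : ℤ)) - t (-((n + 1 : ℕ) : ℤ))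
  have hΔ : ∀ n, 0 < Δ n := fun n => sub_pos.2 (ht.strictAnti (Nat.lt_succ_self n))
  let W : ℕ → ℂ := fun n =>
    ∫ ω, slopePhase t X n ω * Complex.exp ((c * B (t (-(n : ℤ))) ω : ℝ) * Complex.I) ∂P
  let q : ℕ → ℝ := fun n => Real.exp (-(Δ n * (2 * Real.pi / Δ n + c) ^ 2 / 2))
  have hrec : ∀ n, W n = W (n + 1) * (q n : ℝ) := by
    intro n
    have hae : ∀ᵐ ω ∂P,
        slopePhase t X n ω * Complex.exp ((c * B (t (-(n : ℤ))) ω : ℝ) * Complex.I)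
        = (slopePhase t X (n + 1) ω
            * Complex.exp ((c * B (t (-((n + 1 : ℕ) : ℤ))) ω : ℝ) * Complex.I))
          * Complex.exp (((2 * Real.pi / Δ n + c)
            * (B (t (-(n : ℤ))) ω - B (t (-((n + 1 : ℕ) : ℤ))) ω) : ℝ) * Complex.I) := by
      filter_upwards [hsol] with ω hω
      rw [slopePhase, slopePhase, ht.exp_pathSlope (b := fun s => B s ω) hω n]
      simp only [mul_assoc, ← Complex.exp_add, ← add_mul, ← Complex.ofReal_add]
      congr 3
      simp only [Δ]
      ring
    have hm : Measurable[augFilt P B (t (-((n + 1 : ℕ) : ℤ)))] fun ω =>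
        slopePhase t X (n + 1) ω
          * Complex.exp ((c * B (t (-((n + 1 : ℕ) : ℤ))) ω : ℝ) * Complex.I) :=
      measurable_mul_exp_ofReal (ht.measurable_slopePhase hX (n + 1))
        ((measurable_augFilt (ht.pos (n + 1)).le le_rfl).const_mul c)
    exact (integral_congr_ae hae).trans (hB.integral_mul_exp_increment (ht.pos (n + 1)).le
      (ht.strictAnti (Nat.lt_succ_self n)) hm _)
  have hW1 : ∀ n, ‖W n‖ ≤ 1 := by
    intro n
    refine (norm_integral_le_of_norm_le_const (C := 1) (ae_of_all _ fun ω => ?_)).trans (by simp)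
    rw [norm_mul, norm_slopePhase, Complex.norm_exp_ofReal_mul_I, one_mul]
  have hWq : ∀ n, ‖W n‖ = ‖W (n + 1)‖ * q n := fun n => by
    rw [hrec n, norm_mul, Complex.norm_real, Real.norm_of_nonneg (Real.exp_pos _).le]
  have hmono : Monotone fun n => ‖W n‖ := monotone_nat_of_le_succ fun n => by
    rw [hWq n]
    exact mul_le_of_le_one_right (norm_nonneg _)
      (Real.exp_le_one_iff.2 (by have := (hΔ n).le; simp only [neg_nonpos]; positivity))
  have hΔ0 : Tendsto Δ atTop (nhdsWithin 0 (Set.Ioi 0)) := by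
    refine tendsto_nhdsWithin_iff.2 ⟨?_, Eventually.of_forall hΔ⟩
    simpa only [sub_zero] using ht.2.2.sub ((tendsto_add_atTop_iff_nat 1).2 ht.2.2)
  have hq : Tendsto q atTop (nhds 0) := by
    refine Real.tendsto_exp_neg_atTop_nhds_zero.comp ?_
    have hinv : Tendsto (fun n => 2 * Real.pi ^ 2 * (Δ n)⁻¹ + 2 * Real.pi * c) atTop atTop :=
      tendsto_atTop_add_const_right _ _
        ((tendsto_inv_nhdsGT_zero.comp hΔ0).const_mul_atTop (by positivity))
    refine tendsto_atTop_mono (fun n => ?_) hinv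
    have h0 := hΔ n
    have : Δ n * (2 * Real.pi / Δ n + c) ^ 2 / 2
        = 2 * Real.pi ^ 2 * (Δ n)⁻¹ + 2 * Real.pi * c + Δ n * c ^ 2 / 2 := by
      field_simp
      ring
    rw [this]
    exact le_add_of_nonneg_right (by positivity)
  have hW0 : Tendsto (fun n => ‖W n‖) atTop (nhds 0) :=
    squeeze_zero (fun _ => norm_nonneg _) (fun n => by
      rw [hWq n]
      exact mul_le_of_le_one_left (Real.exp_pos _).le (hW1 _)) hq
  exact norm_le_zero_iff.1 (hmono.ge_of_tendsto hW0 n)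

/-- The terminal phase is orthogonal to all characters of `B` on `[0, T]`. -/
lemma IsBM.integral_slopePhase_mul_exp [IsProbabilityMeasure P]
    (hB : IsBM P (natFilt B) B) (ht : TsirelsonTimes T t) (hX : ProgMeas (augFilt P B) X)
    (hsol : ∀ᵐ ω ∂P, ∀ s ∈ Set.Icc (0 : ℝ) T,
      X s ω = (∫ r in Set.Icc (0 : ℝ) s, tsirelsonDrift t r (fun u => X u ω)) + B s ω)
    (f : ℝ →₀ ℝ) (hf : ∀ r ∈ f.support, r ∈ Set.Icc 0 T) :
    ∫ ω, slopePhase t X 0 ω * Complex.exp ((processComb B f ω : ℝ) * Complex.I) ∂P = 0 := by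
  have hdescend : ∀ m k : ℕ, ∀ f : ℝ →₀ ℝ, (∀ r ∈ f.support, t (-((k + m : ℕ) : ℤ)) ≤ r) →
      ∫ ω, slopePhase t X k ω * Complex.exp ((processComb B f ω : ℝ) * Complex.I) ∂P = 0 := by
    intro m
    induction m with
    | zero =>
      intro k f hf
      exact hB.integral_mul_exp_eq_zero_of_present (ht.pos k).le (ht.measurable_slopePhase hX k)
        (fun c => hB.integral_slopePhase_mul_exp_present ht hX hsol c k) f hf
    | succ m ih =>
      intro k f hf
      let c := 2 * Real.pi / (t (-(k : ℤ)) - t (-((k + 1 : ℕ) : ℤ)))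
      let g := Finsupp.single (t (-(k : ℤ))) c + Finsupp.single (t (-((k + 1 : ℕ) : ℤ))) (-c)
      rw [← ih (k + 1) (g + f) ?_]
      · refine integral_congr_ae ?_
        filter_upwards [hsol] with ω hω
        rw [slopePhase, slopePhase, ht.exp_pathSlope (b := fun s => B s ω) hω k]
        simp only [mul_assoc, ← Complex.exp_add, ← add_mul, ← Complex.ofReal_add,
          processComb_add, g, processComb_single]
        congr 3
        simp only [c]
        ring
      · intro r hr
        have hle : ∀ j, j ≤ k + 1 → t (-((k + 1 + m : ℕ) : ℤ)) ≤ t (-(j : ℤ)) := fun j hj =>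
          ht.strictAnti.antitone (by lia)
        rcases Finset.mem_union.1 (Finsupp.support_add hr) with hr | hr
        · rcases Finset.mem_union.1 (Finsupp.support_add hr) with hr | hr
          · rw [Finset.mem_singleton.1 (Finsupp.support_single_subset hr)]
            exact hle k (by lia)
          · rw [Finset.mem_singleton.1 (Finsupp.support_single_subset hr)]
            exact hle (k + 1) le_rfl
        · have := hf r hr
          rwa [show k + (m + 1) = k + 1 + m by ring] at this
  have hev : ∀ᶠ n : ℕ in atTop, ∀ r ∈ (f.erase 0).support, t (-(n : ℤ)) ≤ r := by
    rw [Filter.eventually_all_finset]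
    intro r hr
    rw [Finsupp.support_erase, Finset.mem_erase] at hr
    exact ht.2.2.eventually (ge_mem_nhds (lt_of_le_of_ne (hf r hr.2).1 hr.1.symm))
  obtain ⟨n, hn⟩ := hev.exists
  have := hdescend n 0 (f.erase 0) (by simpa using hn)
  simpa only [processComb_eq_erase_add f 0, hB.1, mul_zero, add_zero] using this

end Solution

/-- Tsirelson. The SDE `X_s = ∫_0^s μ(r, X) dr + B_s` on `[0, T]`,
driven by a one-dimensional Brownian motion `B` with Tsirelson's drift `μ`,
has no strong solution. -/
theorem tsirelson_no_strong_solution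
    (T : ℝ) (hT : 0 < T) (t : ℤ → ℝ) (ht : TsirelsonTimes T t)
    {Ω : Type*} [MeasurableSpace Ω] (P : Measure Ω) [IsProbabilityMeasure P]
    (B : ℝ → Ω → ℝ) (hB : IsBM P (natFilt B) B) :
    ¬ ∃ X : ℝ → Ω → ℝ,
        (∀ ω, Continuous fun s => X s ω) ∧
        ProgMeas (augFilt P B) X ∧
        (∀ᵐ ω ∂P, ∀ s ∈ Set.Icc (0 : ℝ) T,
          X s ω = (∫ r in Set.Icc (0 : ℝ) s, tsirelsonDrift t r (fun u => X u ω)) + B s ω) := by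
  rintro ⟨X, -, hX, hsol⟩
  have hZ : Measurable[augFilt P B T] (slopePhase t X 0) :=
    (ht.measurable_slopePhase hX 0).mono (augFilt_mono (ht.le 0)) le_rfl
  have hnorm : ∀ ω, ‖slopePhase t X 0 ω‖ = 1 := norm_slopePhase 0
  have horth := hB.integral_slopePhase_mul_exp ht hX hsol
  have hint : ∀ f : ℝ →₀ ℝ, (∀ r ∈ f.support, r ∈ Set.Icc 0 T) → Integrable (fun ω =>
      slopePhase t X 0 ω * Complex.exp ((processComb B f ω : ℝ) * Complex.I)) P := by
    intro f hf
    refine Integrable.of_bound (C := 1) (hB.aemeasurable_of_augFilt (s := T)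
      (measurable_mul_exp_ofReal hZ (measurable_processComb fun r hr =>
        measurable_augFilt (hf r hr).1 (hf r hr).2))).aestronglyMeasurable (ae_of_all _ fun ω => ?_)
    rw [norm_mul, hnorm, Complex.norm_exp_ofReal_mul_I, one_mul]
  have hconj : ∀ f : ℝ →₀ ℝ, ∀ ω,
      (starRingEnd ℂ) (slopePhase t X 0 ω) * Complex.exp ((processComb B f ω : ℝ) * Complex.I)
        = (starRingEnd ℂ) (slopePhase t X 0 ω
          * Complex.exp ((processComb B (-f) ω : ℝ) * Complex.I)) := by
    intro f ω
    rw [map_mul, ← Complex.exp_conj, processComb_neg]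
    simp
  have hneg : ∀ f : ℝ →₀ ℝ, (∀ r ∈ f.support, r ∈ Set.Icc 0 T) →
      ∀ r ∈ (-f).support, r ∈ Set.Icc 0 T := fun f hf r hr => hf r (by simpa using hr)
  have hconj_int : ∀ f : ℝ →₀ ℝ, (∀ r ∈ f.support, r ∈ Set.Icc 0 T) → Integrable (fun ω =>
      (starRingEnd ℂ) (slopePhase t X 0 ω)
        * Complex.exp ((processComb B f ω : ℝ) * Complex.I)) P := by
    intro f hf
    simp_rw [hconj f]
    exact Complex.conjCLE.toContinuousLinearMap.integrable_comp (hint _ (hneg f hf))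
  have hconj_orth : ∀ f : ℝ →₀ ℝ, (∀ r ∈ f.support, r ∈ Set.Icc 0 T) → ∫ ω,
      (starRingEnd ℂ) (slopePhase t X 0 ω)
        * Complex.exp ((processComb B f ω : ℝ) * Complex.I) ∂P = 0 := by
    intro f hf
    simp_rw [hconj f]
    rw [integral_conj, horth _ (hneg f hf), map_zero]
  have hre : (fun ω => (slopePhase t X 0 ω).re) =ᵐ[P] 0 := by
    refine hB.ae_eq_zero_of_orthogonal (T := T) (Complex.measurable_re.comp hZ)
      (fun ω => (Complex.abs_re_le_norm _).trans (hnorm ω).le) fun f hf => ?_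
    simp_rw [Complex.re_eq_add_conj, div_mul_eq_mul_div, add_mul]
    rw [integral_div, integral_add (hint f hf) (hconj_int f hf), horth f hf, hconj_orth f hf]
    simp
  have him : (fun ω => (slopePhase t X 0 ω).im) =ᵐ[P] 0 := by
    refine hB.ae_eq_zero_of_orthogonal (T := T) (Complex.measurable_im.comp hZ)
      (fun ω => (Complex.abs_im_le_norm _).trans (hnorm ω).le) fun f hf => ?_
    simp_rw [Complex.im_eq_sub_conj, div_mul_eq_mul_div, sub_mul]
    rw [integral_div, integral_sub (hint f hf) (hconj_int f hf), horth f hf, hconj_orth f hf]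
    simp
  obtain ⟨ω, h1, h2⟩ := (hre.and him).exists
  have h0 : slopePhase t X 0 ω = 0 := Complex.ext h1 h2
  have := hnorm ω
  rw [h0, norm_zero] at this
  exact zero_ne_one this

end
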